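/- If α = (α_1, …, α_n) is an n-tuple of pairwise independent irrational numbers with k(α) = k, then necessarily n ≤ k(k+1)/2. -/

import Mathlib

/-- Distance from `x` to the nearest integer. -/
noncomputable def distToInt (x : ℝ) : ℝ := |x - round x|

/-- The irrationality measure function `ψ_α(t) = min_{1 ≤ q ≤ t} ‖qα‖`. -/
noncomputable def psi (α : ℝ) (t : ℝ) : ℝ :=
  sInf ((fun q : ℤ => distToInt ((q : ℝ) * α)) '' {q : ℤ | 1 ≤ q ∧ (q : ℝ) ≤ t})

/-- An `n`-tuple is pairwise independent if eventually all the values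
`ψ_{α_i}(t)` are pairwise distinct. -/
def PairwiseIndependent {n : ℕ} (α : Fin n → ℝ) : Prop :=
  ∃ T : ℝ, 0 ≤ T ∧ ∀ t : ℝ, T ≤ t → ∀ i j : Fin n, i ≠ j → psi (α i) t ≠ psi (α j) t

/-- `v : Fin n → Fin n` is the order vector of `α` at time `t`:
`ψ_{α_{v 0}}(t) > ψ_{α_{v 1}}(t) > … > ψ_{α_{v (n-1)}}(t)`. -/
def IsOrderVec {n : ℕ} (α : Fin n → ℝ) (t : ℝ) (v : Fin n → Fin n) : Prop :=
  Function.Bijective v ∧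
    ∀ p q : Fin n, p < q → psi (α (v p)) t > psi (α (v q)) t

/-- The order vector `v` occurs at arbitrarily large times. -/
def OccursInfinitely {n : ℕ} (α : Fin n → ℝ) (v : Fin n → Fin n) : Prop :=
  ∀ T : ℝ, ∃ t : ℝ, T < t ∧ IsOrderVec α t v

/-- `k(α)`: the number of distinct order vectors occurring for arbitrarily large `t`. -/
noncomputable def kAlpha {n : ℕ} (α : Fin n → ℝ) : ℕ :=
  Nat.card {v : Fin n → Fin n | OccursInfinitely α v}

/-- The relative order of the functions `ψ_{α_i}` is the same at times `t` and `t'`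
(i.e. the order vectors coincide). -/
def SameOrder {n : ℕ} (α : Fin n → ℝ) (t t' : ℝ) : Prop :=
  ∀ i j : Fin n, (psi (α i) t < psi (α j) t ↔ psi (α i) t' < psi (α j) t')

/-- `ts` is a sequence of moments of permutation changes:
`ts (i+1) = min { t > ts i : v_α(t) ≠ v_α(ts i) }`. -/
def IsChangeSeq {n : ℕ} (α : Fin n → ℝ) (ts : ℕ → ℝ) : Prop :=
  ∀ i : ℕ, IsLeast {t : ℝ | ts i < t ∧ ¬ SameOrder α (ts i) t} (ts (i + 1))

/-- The set of positions `(j,l)`, `1 ≤ j ≤ l ≤ k` (here `0`-based). -/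
def PairIdx (k : ℕ) := {p : Fin k × Fin k // p.1 ≤ p.2}

/-- Construct a position from `0`-based indices `j ≤ l < k`. -/
def mkPos {k : ℕ} (j l : ℕ) (hj : j ≤ l) (hl : l < k) : PairIdx k :=
  ⟨(⟨j, lt_of_le_of_lt hj hl⟩, ⟨l, hl⟩), Fin.mk_le_mk.mpr hj⟩

/-- The position permutation underlying `π`: one has `π(u) = u ∘ tau`.
In `1`-based notation: `tau (i,i) = (i+1,i+1)` for `i < k`, `tau (k,k) = (1,1)`,
`tau (i,k) = (1,i+1)` for `i < k`, and `tau (i,j) = (i+1,j+1)` otherwise. -/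
def tau {k : ℕ} (p : PairIdx k) : PairIdx k :=
  if h2 : p.1.2.val = k - 1 then
    if h1 : p.1.1.val = k - 1 then
      ⟨(⟨0, by have := p.1.2.isLt; omega⟩, ⟨0, by have := p.1.2.isLt; omega⟩), le_refl _⟩
    else
      ⟨(⟨0, by have := p.1.2.isLt; omega⟩,
        ⟨p.1.1.val + 1, by have := p.1.1.isLt; omega⟩),
       Fin.mk_le_mk.mpr (by omega)⟩
  else
    ⟨(⟨p.1.1.val + 1, by have h := p.1.2.isLt; have h' : p.1.1.val ≤ p.1.2.val := p.2; omega⟩,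
      ⟨p.1.2.val + 1, by have h := p.1.2.isLt; omega⟩),
     Fin.mk_le_mk.mpr (by have h' : p.1.1.val ≤ p.1.2.val := p.2; omega)⟩

/-- The action of `π` on vectors indexed by positions: `π(u) = u ∘ tau`. -/
def piMap {k : ℕ} {X : Type*} (u : PairIdx k → X) : PairIdx k → X :=
  fun p => u (tau p)

/-- The (`0`-based) linear position of the pair `(j,l)` in the special enumeration
`u_{1,1}, u_{1,k}, u_{1,k-1}, …, u_{1,2}, u_{2,2}, u_{2,k}, …, u_{k,k}`. -/
def posIdx {k : ℕ} (p : PairIdx k) : ℕ :=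
  (p.1.1.val * k - p.1.1.val * (p.1.1.val - 1) / 2) +
    (if p.1.2.val = p.1.1.val then 0 else k - p.1.2.val)

/-- `v : PairIdx k → Fin n` is the order vector of `α` at time `t`, written in the
special pair enumeration: the function at position `p` is larger than the one at
position `q` whenever `p` precedes `q` in the enumeration. -/
def IsOrderVecP {n k : ℕ} (α : Fin n → ℝ) (t : ℝ) (v : PairIdx k → Fin n) : Prop :=
  Function.Bijective v ∧
    ∀ p q : PairIdx k, posIdx p < posIdx q → psi (α (v p)) t > psi (α (v q)) t

/-- Denominator `q_m` of the `m`-th convergent of the continued fraction of `α`. -/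
noncomputable def cfDen (α : ℝ) (m : ℕ) : ℝ := (GenContFract.of α).dens m

/-- The orbit equivalence relation of the map `tau` on positions. -/
def orbitSetoid (k : ℕ) : Setoid (PairIdx k) where
  r p q := ∃ a b : ℕ, (fun x : PairIdx k => tau x)^[a] p = (fun x : PairIdx k => tau x)^[b] q
  iseqv := by
    constructor
    · exact fun p => ⟨0, 0, rfl⟩
    · rintro p q ⟨a, b, h⟩; exact ⟨b, a, h.symm⟩
    · rintro p q r ⟨a, b, h1⟩ ⟨c, d, h2⟩
      refine ⟨c + a, b + d, ?_⟩
      rw [Function.iterate_add_apply, h1, ← Function.iterate_add_apply,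
        Nat.add_comm c b, Function.iterate_add_apply, h2, ← Function.iterate_add_apply]

/-- The distance from `q * α` to the nearest integer, for a natural number `q`. -/
noncomputable def natDist (α : ℝ) (q : ℕ) : ℝ := distToInt ((q : ℝ) * α)

/-- The signed difference between `q * α` and the nearest integer. -/
noncomputable def signedNatDist (α : ℝ) (q : ℕ) : ℝ := (q : ℝ) * α - round ((q : ℝ) * α)

/-- `q` is a denominator of a best approximation to `α`. -/
def IsJump (α : ℝ) (q : ℕ) : Prop :=
  1 ≤ q ∧ ∀ r, 1 ≤ r → r < q → natDist α q < natDist α r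

/-- `a < b` are consecutive denominators of best approximations to `α`. -/
def IsConsecutive (α : ℝ) (a b : ℕ) : Prop :=
  IsJump α a ∧ IsJump α b ∧ a < b ∧ ∀ r, a < r → r < b → ¬ IsJump α r

lemma abs_signedNatDist (α : ℝ) (q : ℕ) : |signedNatDist α q| = natDist α q := rfl

lemma natDist_le (α : ℝ) (q : ℕ) (m : ℤ) : natDist α q ≤ |(q : ℝ) * α - m| :=
  round_le _ m

lemma natDist_pos {α : ℝ} (hα : Irrational α) {q : ℕ} (hq : 1 ≤ q) : 0 < natDist α q := by
  have h : Irrational ((q : ℝ) * α) := hα.natCast_mul (by omega)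
  have := (h.sub_intCast (round ((q : ℝ) * α))).ne_zero
  exact abs_pos.mpr this

lemma isJump_one (α : ℝ) : IsJump α 1 := ⟨le_rfl, fun r h1 h2 => by omega⟩

lemma exists_isJump_min (α : ℝ) {t : ℕ} (ht : 1 ≤ t) :
    ∃ s, s ≤ t ∧ IsJump α s ∧ ∀ r, 1 ≤ r → r ≤ t → natDist α s ≤ natDist α r := by
  induction t, ht using Nat.le_induction with
  | base => exact ⟨1, le_rfl, isJump_one α, fun r h1 h2 => by rw [show r = 1 by omega]⟩
  | succ t ht ih =>
    obtain ⟨s, hst, hs, hmin⟩ := ih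
    rcases lt_or_ge (natDist α (t + 1)) (natDist α s) with h | h
    · refine ⟨t + 1, le_rfl, ⟨by omega, fun r h1 h2 => h.trans_le (hmin r h1 (by omega))⟩, ?_⟩
      intro r h1 h2
      rcases Nat.lt_or_ge t r with h3 | h3
      · rw [show r = t + 1 by omega]
      · exact h.le.trans (hmin r h1 h3)
    · refine ⟨s, by omega, hs, fun r h1 h2 => ?_⟩
      rcases Nat.lt_or_ge t r with h3 | h3
      · rw [show r = t + 1 by omega]; exact h
      · exact hmin r h1 h3

lemma psi_eq_natDist {α : ℝ} {s t : ℕ} (hs : 1 ≤ s) (hst : s ≤ t)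
    (hmin : ∀ r, 1 ≤ r → r ≤ t → natDist α s ≤ natDist α r) : psi α t = natDist α s := by
  apply IsLeast.csInf_eq
  constructor
  · exact ⟨(s : ℤ), ⟨by exact_mod_cast hs, by exact_mod_cast hst⟩, by simp [natDist]⟩
  · rintro _ ⟨q, ⟨h1, h2⟩, rfl⟩
    lift q to ℕ using by omega
    have h3 : q ≤ t := by exact_mod_cast h2
    have := hmin q (by exact_mod_cast h1) h3
    simpa [natDist] using this

lemma psi_antitone {α : ℝ} {s t : ℕ} (hs : 1 ≤ s) (hst : s ≤ t) : psi α t ≤ psi α s := by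
  obtain ⟨u, hu, hju, hmu⟩ := exists_isJump_min α hs
  obtain ⟨v, hv, hjv, hmv⟩ := exists_isJump_min α (hs.trans hst)
  rw [psi_eq_natDist hju.1 hu hmu, psi_eq_natDist hjv.1 hv hmv]
  exact hmv u hju.1 (hu.trans hst)

lemma IsConsecutive.le_natDist {α : ℝ} {a b : ℕ} (h : IsConsecutive α a b) {r : ℕ}
    (hr : 1 ≤ r) (hrb : r < b) : natDist α a ≤ natDist α r := by
  obtain ⟨ha, hb, hab, hno⟩ := h
  have ha1 := ha.1
  obtain ⟨s, hst, hs, hmin⟩ := exists_isJump_min α (t := b - 1) (by omega)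
  have hsa : s = a := by
    rcases lt_trichotomy s a with h | h | h
    · exact absurd (hmin a ha.1 (by omega)) (not_le.mpr (ha.2 s hs.1 h))
    · exact h
    · exact absurd hs (hno s h (by omega))
  exact hsa ▸ hmin r hr (by omega)

lemma IsConsecutive.psi_eq {α : ℝ} {a b : ℕ} (h : IsConsecutive α a b) {t : ℕ}
    (hat : a ≤ t) (htb : t < b) : psi α t = natDist α a :=
  psi_eq_natDist h.1.1 hat fun _ h1 h2 => h.le_natDist h1 (by omega)

lemma IsJump.psi_eq {α : ℝ} {a : ℕ} (h : IsJump α a) : psi α a = natDist α a :=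
  psi_eq_natDist h.1 le_rfl fun r h1 h2 => by
    rcases h2.lt_or_eq with h3 | rfl
    · exact (h.2 r h1 h3).le
    · exact le_rfl

lemma exists_natDist_lt (α : ℝ) {ε : ℝ} (hε : 0 < ε) : ∃ q, 1 ≤ q ∧ natDist α q < ε := by
  obtain ⟨m, hm⟩ := exists_nat_one_div_lt hε
  obtain ⟨j, k, hk, hkm, h⟩ := Real.exists_int_int_abs_mul_sub_le α (n := m + 1) (by omega)
  lift k to ℕ using hk.le
  refine ⟨k, by exact_mod_cast hk, (natDist_le α k j).trans_lt ?_⟩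
  rw [Int.cast_natCast] at h
  refine (h.trans ?_).trans_lt hm
  push_cast
  gcongr
  linarith

lemma exists_isJump_gt {α : ℝ} (hα : Irrational α) (t : ℕ) : ∃ q, t < q ∧ IsJump α q := by
  classical
  obtain ⟨s, hst, hs, hmin⟩ := exists_isJump_min α (t := t + 1) (by omega)
  have hex := exists_natDist_lt α (natDist_pos hα hs.1)
  obtain ⟨h1, h2⟩ := Nat.find_spec hex
  have hlt : t < Nat.find hex := by
    by_contra hc
    exact absurd (hmin _ h1 (by omega)) (not_le.mpr h2)
  refine ⟨_, hlt, h1, fun r hr1 hr2 => ?_⟩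
  have := Nat.find_min hex hr2
  push Not at this
  exact h2.trans_le (this hr1)

lemma exists_isConsecutive {α : ℝ} (hα : Irrational α) {t : ℕ} (ht : 1 ≤ t) :
    ∃ a b, IsConsecutive α a b ∧ a ≤ t ∧ t < b := by
  classical
  obtain ⟨s, hst, hs, hmin⟩ := exists_isJump_min α ht
  have hex := exists_isJump_gt hα t
  obtain ⟨h1, h2⟩ := Nat.find_spec hex
  refine ⟨s, Nat.find hex, ⟨hs, h2, by omega, fun r hr1 hr2 hr => ?_⟩, hst, h1⟩
  rcases Nat.lt_or_ge t r with h3 | h3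
  · exact Nat.find_min hex hr2 ⟨h3, hr⟩
  · exact absurd (hmin r hr.1 h3) (not_le.mpr (hr.2 s hs.1 hr1))

lemma IsJump.exists_next {α : ℝ} (hα : Irrational α) {a : ℕ} (ha : IsJump α a) :
    ∃ b, IsConsecutive α a b := by
  obtain ⟨a', b, h, h1, h2⟩ := exists_isConsecutive hα ha.1
  obtain rfl : a' = a := by
    rcases h1.lt_or_eq with h3 | h3
    · exact absurd ha (h.2.2.2 a h3 h2)
    · exact h3
  exact ⟨b, h⟩

lemma IsJump.exists_prev {α : ℝ} (hα : Irrational α) {b : ℕ} (hb : IsJump α b) (hb2 : 2 ≤ b) :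
    ∃ a, IsConsecutive α a b := by
  obtain ⟨a, b', h, h1, h2⟩ := exists_isConsecutive hα (t := b - 1) (by omega)
  obtain rfl : b' = b := by
    rcases Nat.lt_or_ge b b' with h3 | h3
    · exact absurd hb (h.2.2.2 b (by omega) h3)
    · omega
  exact ⟨a, h⟩

lemma IsConsecutive.le_of_isJump {α : ℝ} {a b q : ℕ} (h : IsConsecutive α a b)
    (hq : IsJump α q) (haq : a < q) : b ≤ q :=
  not_lt.mp fun hlt => h.2.2.2 q haq hlt hq

lemma IsConsecutive.ge_of_isJump {α : ℝ} {a b q : ℕ} (h : IsConsecutive α a b)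
    (hq : IsJump α q) (hqb : q < b) : q ≤ a :=
  not_lt.mp fun hlt => h.2.2.2 q hlt hqb hq

lemma psi_eq_pred_of_not_isJump {α : ℝ} (hα : Irrational α) {t : ℕ} (ht : 2 ≤ t)
    (h : ¬ IsJump α t) : psi α (t - 1 : ℕ) = psi α t := by
  obtain ⟨a, b, hab, h1, h2⟩ := exists_isConsecutive hα (t := t) (by omega)
  have : a ≠ t := fun he => h (he ▸ hab.1)
  rw [hab.psi_eq h1 h2, hab.psi_eq (t := t - 1) (by omega) (by omega)]

lemma IsConsecutive.signedNatDist_mul_neg {α : ℝ} (hα : Irrational α) {a b : ℕ}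
    (h : IsConsecutive α a b) : signedNatDist α a * signedNatDist α b < 0 := by
  have hab := h.2.2.1
  have ha1 := h.1.1
  have hpa := natDist_pos hα h.1.1
  have hpb := natDist_pos hα h.2.1.1
  have hlt := h.2.1.2 a h.1.1 hab
  have hle := h.le_natDist (r := b - a) (by omega) (by omega)
  have hdiff := natDist_le α (b - a) (round ((b : ℝ) * α) - round ((a : ℝ) * α))
  have heq : ((b - a : ℕ) : ℝ) * α
      - ((round ((b : ℝ) * α) - round ((a : ℝ) * α) : ℤ) : ℝ)
      = signedNatDist α b - signedNatDist α a := by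
    rw [Nat.cast_sub hab.le]
    push_cast
    unfold signedNatDist
    ring
  rw [heq] at hdiff
  have hle' := hle.trans hdiff
  rw [← abs_signedNatDist] at hpa hpb hlt hle'
  rw [← abs_signedNatDist] at hlt
  by_contra hc
  push Not at hc
  rcases abs_cases (signedNatDist α a) with ⟨e1, _⟩ | ⟨e1, _⟩ <;>
  rcases abs_cases (signedNatDist α b) with ⟨e2, _⟩ | ⟨e2, _⟩ <;>
  rcases abs_cases (signedNatDist α b - signedNatDist α a) with ⟨e3, _⟩ | ⟨e3, _⟩ <;>
  rw [e1, e2] at hlt <;> rw [e1] at hpa hle' <;> rw [e2] at hpb <;> rw [e3] at hle' <;>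
  nlinarith

lemma mul_signedNatDist_sub (α : ℝ) (a b : ℕ) :
    (b : ℝ) * signedNatDist α a - a * signedNatDist α b
      = ((a * round ((b : ℝ) * α) - b * round ((a : ℝ) * α) : ℤ) : ℝ) := by
  unfold signedNatDist
  push_cast
  ring

lemma IsConsecutive.mul_add_mul_eq_abs {α : ℝ} (hα : Irrational α) {a b : ℕ}
    (h : IsConsecutive α a b) : (b : ℝ) * natDist α a + a * natDist α b
      = |((a * round ((b : ℝ) * α) - b * round ((a : ℝ) * α) : ℤ) : ℝ)| := by
  have ha : (0 : ℝ) < a := by exact_mod_cast h.1.1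
  have hb : (0 : ℝ) < b := by exact_mod_cast h.2.1.1
  rw [← mul_signedNatDist_sub, ← abs_signedNatDist, ← abs_signedNatDist]
  rcases mul_neg_iff.mp (h.signedNatDist_mul_neg hα) with ⟨h1, h2⟩ | ⟨h1, h2⟩
  · rw [abs_of_pos h1, abs_of_neg h2, abs_of_pos (by nlinarith)]; ring
  · rw [abs_of_neg h1, abs_of_pos h2, abs_of_neg (by nlinarith)]; ring

lemma IsConsecutive.mul_add_mul {α : ℝ} (hα : Irrational α) {a b : ℕ}
    (h : IsConsecutive α a b) : (b : ℝ) * natDist α a + a * natDist α b = 1 := by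
  have hab := h.2.2.1
  have ha1 := h.1.1
  have ha : (0 : ℝ) < a := by exact_mod_cast h.1.1
  have hba : (a : ℝ) < b := by exact_mod_cast hab
  have hpa := natDist_pos hα h.1.1
  have hpb := natDist_pos hα h.2.1.1
  have hlt := h.2.1.2 a h.1.1 hab
  have hdir : (b : ℝ) * natDist α a ≤ 1 := by
    obtain ⟨j, k, hk, hkm, hjk⟩ := Real.exists_int_int_abs_mul_sub_le α (n := b - 1) (by omega)
    lift k to ℕ using hk.le
    have h1 := h.le_natDist (r := k) (by omega) (by omega)
    have h2 := natDist_le α k j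
    rw [Int.cast_natCast] at hjk
    have h3 : natDist α a ≤ 1 / b := by
      refine (h1.trans h2).trans (hjk.trans_eq ?_)
      rw [Nat.cast_sub (by omega)]
      simp
    rw [le_div_iff₀ (by linarith)] at h3
    linarith
  have key := h.mul_add_mul_eq_abs hα
  set M := (a * round ((b : ℝ) * α) - b * round ((a : ℝ) * α) : ℤ)
  rw [key]
  have hpos : (0 : ℝ) < |(M : ℝ)| := by rw [← key]; nlinarith
  have hlt2 : |(M : ℝ)| < 2 := by rw [← key]; nlinarith
  have h1 : 0 < |M| := by exact_mod_cast hpos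
  have h2 : |M| < 2 := by exact_mod_cast hlt2
  have h3 : |M| = 1 := by omega
  exact_mod_cast h3

lemma IsConsecutive.recurrence {α : ℝ} (hα : Irrational α) {a b c : ℕ}
    (hab : IsConsecutive α a b) (hbc : IsConsecutive α b c) :
    ∃ E : ℤ, (c : ℝ) = E * b + a ∧ 1 ≤ E ∧ (c : ℝ) * natDist α a = E + a * natDist α c := by
  have hb : (0 : ℝ) < b := by exact_mod_cast hbc.1.1
  have hcb : (b : ℝ) < c := by exact_mod_cast hbc.2.2.1
  have hba : (a : ℝ) < b := by exact_mod_cast hab.2.2.1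
  have e1 := hab.mul_add_mul hα
  have e2 := hbc.mul_add_mul hα
  have s1 := hab.signedNatDist_mul_neg hα
  have s2 := hbc.signedNatDist_mul_neg hα
  have hM := mul_signedNatDist_sub α a c
  set M := (a * round ((c : ℝ) * α) - c * round ((a : ℝ) * α) : ℤ)
  have key : ∃ E : ℤ, (c : ℝ) * natDist α a - a * natDist α c = E := by
    rw [← abs_signedNatDist, ← abs_signedNatDist]
    rcases mul_neg_iff.mp s1 with ⟨h1, h2⟩ | ⟨h1, h2⟩
    · have h3 : 0 < signedNatDist α c := by nlinarith
      exact ⟨M, by rw [abs_of_pos h1, abs_of_pos h3, hM]⟩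
    · have h3 : signedNatDist α c < 0 := by nlinarith
      exact ⟨-M, by rw [abs_of_neg h1, abs_of_neg h3]; push_cast; rw [← hM]; ring⟩
  obtain ⟨E, hE⟩ := key
  have hc : (c : ℝ) = E * b + a := by
    rw [← hE]
    linear_combination (-(c : ℝ)) * e1 + (a : ℝ) * e2
  refine ⟨E, hc, ?_, by linarith⟩
  have : (0 : ℝ) < E := by
    by_contra hn
    nlinarith
  exact_mod_cast this

lemma IsConsecutive.add_le {α : ℝ} (hα : Irrational α) {a b c : ℕ}
    (hab : IsConsecutive α a b) (hbc : IsConsecutive α b c) : a + b ≤ c := by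
  obtain ⟨E, hE, hE1, -⟩ := hab.recurrence hα hbc
  have hE' : (1 : ℝ) ≤ E := by exact_mod_cast hE1
  have : ((a + b : ℕ) : ℝ) ≤ c := by
    push_cast
    nlinarith [Nat.cast_nonneg (α := ℝ) b]
  exact_mod_cast this

/-- An upper function has to jump before the lower one has jumped twice. -/
lemma next_lt_of_psi_lt {γ β : ℝ} (hγ : Irrational γ) (hβ : Irrational β) {a b s s' s'' t : ℕ}
    (hab : IsConsecutive γ a b) (hat : a ≤ t) (htb : t < b)
    (hs : IsConsecutive β s s') (hs' : IsConsecutive β s' s'') (hst : s ≤ t) (hts : t < s')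
    (hlt : psi β t < psi γ t) : b < s'' := by
  rw [hs.psi_eq hst hts, hab.psi_eq hat htb] at hlt
  have e1 := hab.mul_add_mul hγ
  have e2 := hs.mul_add_mul hβ
  have hadd : ((s + s' : ℕ) : ℝ) ≤ s'' := by exact_mod_cast hs.add_le hβ hs'
  push_cast at hadd
  have p1 := natDist_pos hγ hab.2.1.1
  have p2 := natDist_pos hβ hs.1.1
  have hdec := hs.2.1.2 s hs.1.1 hs.2.2.1
  have ha : (0 : ℝ) < a := by exact_mod_cast hab.1.1
  have hb : (0 : ℝ) < b := by exact_mod_cast hab.2.1.1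
  have hs0 : (0 : ℝ) < s := by exact_mod_cast hs.1.1
  have h1 : (b : ℝ) * natDist β s < 1 := by nlinarith
  have h2 : 1 < ((s : ℝ) + s') * natDist β s := by nlinarith
  have h3 : (b : ℝ) < s + s' := lt_of_mul_lt_mul_right (h1.trans h2) p2.le
  exact_mod_cast h3.trans_le hadd

/-- If `ψ_β < ψ_α` at two consecutive jumps `a < b` of `ψ_α`, then `ψ_β` is constant
on `[a, b]`. -/
lemma not_isJump_of_psi_lt {α β : ℝ} (hα : Irrational α) (hβ : Irrational β) {a b q : ℕ}
    (hab : IsConsecutive α a b) (h1 : psi β a < psi α a) (h2 : psi β b < psi α b)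
    (haq : a < q) (hqb : q ≤ b) : ¬ IsJump β q := by
  intro hq
  obtain ⟨s, s', hs, hsa, has⟩ := exists_isConsecutive hβ hab.1.1
  obtain ⟨s'', hs'⟩ := hs.2.1.exists_next hβ
  have hsq := hs.le_of_isJump hq (by omega)
  have hb := next_lt_of_psi_lt hα hβ hab le_rfl hab.2.2.1 hs hs' hsa has h1
  rw [hs.psi_eq hsa has, hab.1.psi_eq] at h1
  rw [hs'.psi_eq (hsq.trans hqb) hb, hab.2.1.psi_eq] at h2
  have e1 := hab.mul_add_mul hα
  have e2 := hs.mul_add_mul hβ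
  have p1 := natDist_pos hα hab.1.1
  have p2 := natDist_pos hα hab.2.1.1
  have c1 : (s' : ℝ) ≤ b := by exact_mod_cast hsq.trans hqb
  have c2 : (s : ℝ) ≤ a := by exact_mod_cast hsa
  have c3 : (0 : ℝ) < s := by exact_mod_cast hs.1.1
  have c4 : (0 : ℝ) < s' := by exact_mod_cast hs.2.1.1
  nlinarith [mul_lt_mul_of_pos_left h1 c4, mul_lt_mul_of_pos_left h2 c3,
    mul_le_mul_of_nonneg_right c1 p1.le, mul_le_mul_of_nonneg_right c2 p2.le]

lemma exists_psi_lt {α β : ℝ} (hα : Irrational α) (hβ : Irrational β)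
    (hne : ∃ T : ℕ, ∀ t : ℕ, T ≤ t → psi α t ≠ psi β t) (N : ℕ) :
    ∃ t : ℕ, N ≤ t ∧ psi α t < psi β t := by
  by_contra! hcon
  obtain ⟨T, hT⟩ := hne
  have hlt : ∀ t : ℕ, N + T ≤ t → psi β t < psi α t := fun t ht =>
    lt_of_le_of_ne (hcon t (by omega)) (hT t (by omega)).symm
  obtain ⟨a, ha, hja⟩ := exists_isJump_gt hα (N + T)
  obtain ⟨q, hq, hjq⟩ := exists_isJump_gt hβ a
  have hq1 := hjq.1
  have ha1 := hja.1
  obtain ⟨c, d, hcd, hcq, hqd⟩ := exists_isConsecutive hα (t := q - 1) (by omega)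
  have hac : a ≤ c := hcd.ge_of_isJump hja (by omega)
  exact not_isJump_of_psi_lt hα hβ hcd (hlt c (by omega)) (hlt d (by omega)) (q := q)
    (by omega) (by omega) hjq

lemma distToInt_eq_of_add_int {x y : ℝ} {m : ℤ} (h : x = y + m ∨ x = -y + m) :
    distToInt x = distToInt y := by
  have hle : ∀ x y : ℝ, ∀ m : ℤ, (x = y + m ∨ x = -y + m) → distToInt x ≤ distToInt y := by
    rintro x y m (rfl | rfl)
    · refine (round_le _ (round y + m)).trans_eq ?_
      unfold distToInt
      push_cast
      ring_nf
    · refine (round_le _ (-round y + m)).trans_eq ?_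
      unfold distToInt
      rw [← abs_neg]
      push_cast
      ring_nf
  rcases h with h | h
  · exact (hle x y m (.inl h)).antisymm (hle y x (-m) (.inl (by rw [h]; push_cast; ring)))
  · exact (hle x y m (.inr h)).antisymm (hle y x m (.inr (by rw [h]; ring)))

lemma psi_eq_of_add_int {α β : ℝ} {m : ℤ} (h : α = β + m ∨ α = -β + m) (t : ℝ) :
    psi α t = psi β t := by
  unfold psi
  congr 1
  refine Set.image_congr fun q _ => distToInt_eq_of_add_int (m := q * m) ?_
  rcases h with rfl | rfl
  · left; push_cast; ring
  · right; push_cast; ring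

/-- Two numbers sharing a pair of consecutive best approximation denominators agree, up to sign
and integers, to within `1 / b`. -/
lemma exists_abs_sub_le_of_isConsecutive {α β : ℝ} (hα : Irrational α) (hβ : Irrational β)
    {a b : ℕ} (h₁ : IsConsecutive α a b) (h₂ : IsConsecutive β a b) :
    ∃ m : ℤ, (b : ℝ) * |α - β - m| ≤ 1 ∨ (b : ℝ) * |α + β - m| ≤ 1 := by
  have hb : (0 : ℝ) < b := by exact_mod_cast h₁.2.1.1
  have e1 := h₁.mul_add_mul_eq_abs hα
  have e2 := h₂.mul_add_mul_eq_abs hβ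
  rw [h₁.mul_add_mul hα] at e1
  rw [h₂.mul_add_mul hβ] at e2
  have f1 : |(a * round ((b : ℝ) * α) - b * round ((a : ℝ) * α) : ℤ)| = 1 := by
    exact_mod_cast e1.symm
  have f2 : |(a * round ((b : ℝ) * β) - b * round ((a : ℝ) * β) : ℤ)| = 1 := by
    exact_mod_cast e2.symm
  have d1 : |(b : ℝ) * α - round ((b : ℝ) * α)| ≤ 1 / 2 := abs_sub_round _
  have d2 : |(b : ℝ) * β - round ((b : ℝ) * β)| ≤ 1 / 2 := abs_sub_round _
  generalize round ((b : ℝ) * α) = P at *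
  generalize round ((b : ℝ) * β) = R at *
  generalize round ((a : ℝ) * α) = P' at *
  generalize round ((a : ℝ) * β) = R' at *
  have hcop : IsCoprime (b : ℤ) a := by
    rcases (abs_eq zero_le_one).mp f1 with h | h
    · exact ⟨-P', P, by linear_combination h⟩
    · exact ⟨P', -P, by linear_combination -h⟩
  rw [abs_le] at d1 d2
  have hdvd : (b : ℤ) ∣ P - R ∨ (b : ℤ) ∣ P + R := by
    rcases (abs_eq zero_le_one).mp f1 with h | h <;> rcases (abs_eq zero_le_one).mp f2 with h' | h'
    · exact .inl (hcop.dvd_of_dvd_mul_left ⟨P' - R', by linear_combination h - h'⟩)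
    · exact .inr (hcop.dvd_of_dvd_mul_left ⟨P' + R', by linear_combination h + h'⟩)
    · exact .inr (hcop.dvd_of_dvd_mul_left ⟨P' + R', by linear_combination h + h'⟩)
    · exact .inl (hcop.dvd_of_dvd_mul_left ⟨P' - R', by linear_combination h - h'⟩)
  rcases hdvd with ⟨m, hm⟩ | ⟨m, hm⟩
  · have hm' : (P : ℝ) - R = b * m := by exact_mod_cast hm
    refine ⟨m, .inl ?_⟩
    rw [← abs_of_pos hb, ← abs_mul, abs_le]
    constructor <;> linarith
  · have hm' : (P : ℝ) + R = b * m := by exact_mod_cast hm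
    refine ⟨m, .inr ?_⟩
    rw [← abs_of_pos hb, ← abs_mul, abs_le]
    constructor <;> linarith

lemma exists_forall_not_isConsecutive {α β : ℝ} (hα : Irrational α) (hβ : Irrational β)
    (hne : ∃ t, psi α t ≠ psi β t) :
    ∃ N : ℕ, ∀ a b, N ≤ b → IsConsecutive α a b → ¬ IsConsecutive β a b := by
  obtain ⟨t, ht⟩ := hne
  have hsub : 0 < distToInt (α - β) := abs_pos.mpr fun h =>
    ht (psi_eq_of_add_int (.inl (by linear_combination h)) t)
  have hadd : 0 < distToInt (α + β) := abs_pos.mpr fun h =>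
    ht (psi_eq_of_add_int (.inr (by linear_combination h)) t)
  obtain ⟨N₁, hN₁⟩ := exists_nat_gt (1 / distToInt (α - β))
  obtain ⟨N₂, hN₂⟩ := exists_nat_gt (1 / distToInt (α + β))
  rw [div_lt_iff₀ hsub] at hN₁
  rw [div_lt_iff₀ hadd] at hN₂
  refine ⟨max N₁ N₂, fun a b hb h₁ h₂ => ?_⟩
  have hb₁ : (N₁ : ℝ) ≤ b := by exact_mod_cast (le_max_left _ _).trans hb
  have hb₂ : (N₂ : ℝ) ≤ b := by exact_mod_cast (le_max_right _ _).trans hb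
  obtain ⟨m, hm | hm⟩ := exists_abs_sub_le_of_isConsecutive hα hβ h₁ h₂
  · have h3 : distToInt (α - β) ≤ |α - β - m| := round_le _ m
    nlinarith [Nat.cast_nonneg (α := ℝ) b]
  · have h3 : distToInt (α + β) ≤ |α + β - m| := round_le _ m
    nlinarith [Nat.cast_nonneg (α := ℝ) b]

/-- If `ψ_y < ψ_z` on `[T, b)`, both jump at `b` where their order is reversed, and `ψ_y`
jumps at `T`, then `ψ_y` has no further jump between `T` and `b`. -/
lemma le_of_reversal {y z : ℝ} (hy : Irrational y) (hz : Irrational z) {T c b : ℕ}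
    (hlt : ∀ t, T ≤ t → t < b → psi y t < psi z t) (hb : psi z b < psi y b)
    (hjz : IsJump z b) (hcb : IsConsecutive y c b) (hjT : IsJump y T) : c ≤ T := by
  by_contra! hTc
  have hT1 := hjT.1
  have hcb' := hcb.2.2.1
  obtain ⟨y₁, hy₁⟩ := hjT.exists_next hy
  obtain ⟨y₂, hy₂⟩ := hy₁.2.1.exists_next hy
  have hy₁c : y₁ ≤ c := hy₁.le_of_isJump hcb.1 hTc
  have hy₂b : y₂ ≤ b := hy₂.le_of_isJump hcb.2.1 (by omega)
  obtain ⟨x₀, x₁, hx, hx₀T, hTx₁⟩ := exists_isConsecutive hz hT1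
  have hx₁b : x₁ < b := (next_lt_of_psi_lt hz hy hx hx₀T hTx₁ hy₁ hy₂ le_rfl hy₁.2.2.1
    (hlt T le_rfl (by omega))).trans_le hy₂b
  obtain ⟨w, hw⟩ := hjz.exists_prev hz (by omega)
  have hx₁w : x₁ ≤ w := hw.ge_of_isJump hx.2.1 hx₁b
  have hwb := hw.2.2.1
  have hcw : c ≤ w := by
    obtain ⟨s, s', hs, hsw, hws'⟩ := exists_isConsecutive hy hw.1.1
    obtain ⟨s'', hs'⟩ := hs.2.1.exists_next hy
    have h1 := next_lt_of_psi_lt hz hy hw le_rfl hwb hs hs' hsw hws' (hlt w (by omega) hwb)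
    by_contra! hwc
    have h2 := hs.le_of_isJump hcb.1 (by omega)
    have h3 := hs'.le_of_isJump hcb.2.1 (by omega)
    omega
  have hcx : c ≤ x₁ := by
    by_contra! hxc
    obtain ⟨u, v, huv, hu, hv⟩ := exists_isConsecutive hz (t := c - 1) (by omega)
    have hxu : x₁ ≤ u := huv.ge_of_isJump hx.2.1 (by omega)
    have hvw : v ≤ w := huv.le_of_isJump hw.1 (by omega)
    exact not_isJump_of_psi_lt hz hy huv (hlt u (by omega) (by omega))
      (hlt v (by omega) (by omega)) (q := c) (by omega) (by omega) hcb.1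
  have hx₁y₂ := next_lt_of_psi_lt hz hy hx hx₀T hTx₁ hy₁ hy₂ le_rfl hy₁.2.2.1
    (hlt T le_rfl (by omega))
  obtain rfl : y₂ = b := by
    by_contra hne
    have := hcb.ge_of_isJump hy₂.2.1 (by omega)
    omega
  obtain ⟨E, hE, hE1, hEdist⟩ := hy₁.recurrence hy hy₂
  have hψ := hlt T le_rfl (by omega)
  rw [hy₁.psi_eq le_rfl hy₁.2.2.1, hx.psi_eq hx₀T hTx₁] at hψ
  rw [hjz.psi_eq, hy₂.2.1.psi_eq] at hb
  have e := hx.mul_add_mul hz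
  have hM := mul_signedNatDist_sub z x₀ y₂
  set M := (x₀ * round ((y₂ : ℝ) * z) - y₂ * round ((x₀ : ℝ) * z) : ℤ)
  have k₀ : (0 : ℝ) < x₀ := by exact_mod_cast hx.1.1
  have k₁ : (0 : ℝ) < y₂ := by exact_mod_cast hy₂.2.1.1
  have hMabs : |(M : ℝ)| ≤ y₂ * natDist z x₀ + x₀ * natDist z y₂ := by
    rw [← hM, ← abs_signedNatDist, ← abs_signedNatDist]
    refine (abs_sub _ _).trans_eq ?_
    rw [abs_mul, abs_mul, abs_of_pos k₀, abs_of_pos k₁]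
  have hMabs' : y₂ * natDist z x₀ ≤ |(M : ℝ)| + x₀ * natDist z y₂ := by
    rw [← hM, ← abs_signedNatDist, ← abs_signedNatDist]
    have := abs_sub_abs_le_abs_sub ((y₂ : ℝ) * signedNatDist z x₀) (x₀ * signedNatDist z y₂)
    rw [abs_mul, abs_mul, abs_of_pos k₀, abs_of_pos k₁] at this
    linarith
  have c₀ : (x₀ : ℝ) ≤ T := by exact_mod_cast hx₀T
  have c₁ : (y₁ : ℝ) ≤ x₁ := by exact_mod_cast hy₁c.trans hcx
  have c₂ : (x₁ : ℝ) ≤ y₂ := by exact_mod_cast hx₁b.le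
  have c₃ : (T : ℝ) < y₁ := by exact_mod_cast hy₁.2.2.1
  have p₁ := natDist_pos hz hy₂.2.1.1
  have p₂ := natDist_pos hz hx.2.1.1
  have hEM : (E : ℝ) < |(M : ℝ)| := by
    nlinarith [mul_lt_mul_of_pos_left hψ k₁, mul_le_mul_of_nonneg_right c₀ p₁.le]
  have hEM' : E + 1 ≤ |M| := by
    have : E < |M| := by exact_mod_cast hEM
    omega
  have hEM'' : (E : ℝ) + 1 ≤ |(M : ℝ)| := by exact_mod_cast hEM'
  have hdec : natDist z y₂ ≤ natDist z x₁ := (hjz.2 x₁ hx.2.1.1 hx₁b).le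
  have hMx : |(M : ℝ)| * x₁ ≤ y₂ := by
    have h1 : |(M : ℝ)| * x₁ ≤ (y₂ * natDist z x₀ + x₀ * natDist z y₂) * x₁ :=
      mul_le_mul_of_nonneg_right hMabs (by positivity)
    have h2 : (x₁ : ℝ) * natDist z y₂ ≤ y₂ * natDist z x₁ := by
      gcongr
    nlinarith [mul_le_mul_of_nonneg_left h2 k₀.le]
  have hE0 : (0 : ℝ) ≤ E := by exact_mod_cast (by omega : (0 : ℤ) ≤ E)
  nlinarith

lemma psi_lt_of_isJump {y z : ℝ} (hy : Irrational y) (hz : Irrational z) {T a b : ℕ}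
    (hjz : IsJump z b) (hjT : IsJump y T) (hab : IsConsecutive y a b) (hTa : T < a)
    (hne : ∀ t, T ≤ t → psi y t ≠ psi z t)
    (hconst : ∀ t, T ≤ t → t < b → (psi y t < psi z t ↔ psi y T < psi z T)) :
    psi z T < psi y T := by
  by_contra! hle
  have hlt := lt_of_le_of_ne hle (hne T le_rfl)
  have hT := hjT.1
  have hab' := hab.2.2.1
  rcases lt_or_gt_of_ne (hne b (by omega)) with hb | hb
  · obtain ⟨c, hc⟩ := hjz.exists_prev hz (by omega)
    have hc' : ¬ psi y c < psi z c := fun h =>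
      not_isJump_of_psi_lt hz hy hc h hb hc.2.2.1 le_rfl hab.2.1
    have hcT : c < T := by
      by_contra! hTc
      exact hc' ((hconst c hTc hc.2.2.1).2 hlt)
    obtain ⟨s', hs⟩ := hjT.exists_next hy
    obtain ⟨s'', hs'⟩ := hs.2.1.exists_next hy
    have hsa := hs.le_of_isJump hab.1 hTa
    have hsb := hs'.le_of_isJump hab.2.1 (by omega)
    have := next_lt_of_psi_lt hz hy hc hcT.le (by omega) hs hs' le_rfl hs.2.2.1 hlt
    omega
  · have := le_of_reversal hy hz (fun t h1 h2 => (hconst t h1 h2).2 hlt) hb hjz hab hjT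
    omega

lemma eq_of_forall_pred_eq {X : Type*} {g : ℕ → X} {s t : ℕ} (hst : s ≤ t)
    (h : ∀ u, s < u → u ≤ t → g (u - 1) = g u) : g t = g s := by
  induction t, hst using Nat.le_induction with
  | base => rfl
  | succ t hst ih =>
    rw [← ih fun u h1 h2 => h u h1 (by omega)]
    exact (h (t + 1) (by omega) le_rfl).symm

/-- The pairs `(i, j)` of indices in `L` such that `ψ_{α_i}(t) < ψ_{α_j}(t)`. -/
def orderOn {n : ℕ} (α : Fin n → ℝ) (L : Finset (Fin n)) (t : ℕ) : Set (Fin n × Fin n) :=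
  {p | p.1 ∈ L ∧ p.2 ∈ L ∧ psi (α p.1) t < psi (α p.2) t}

/-- The number of distinct orders of the functions indexed by `L` at times in `W`. -/
noncomputable def orderCount {n : ℕ} (α : Fin n → ℝ) (L : Finset (Fin n)) (W : Set ℕ) : ℕ :=
  (orderOn α L '' W).ncard

section Order

variable {n : ℕ} {α : Fin n → ℝ}

lemma orderOn_eq_iff {L : Finset (Fin n)} {s t : ℕ} : orderOn α L s = orderOn α L t ↔
    ∀ i ∈ L, ∀ j ∈ L, (psi (α i) s < psi (α j) s ↔ psi (α i) t < psi (α j) t) := by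
  simp only [orderOn, Set.ext_iff, Set.mem_ofPred_eq, Prod.forall]
  grind

lemma image_orderOn {L L' : Finset (Fin n)} (h : L' ⊆ L) (W : Set ℕ) :
    orderOn α L' '' W = (fun S => {p ∈ S | p.1 ∈ L' ∧ p.2 ∈ L'}) '' (orderOn α L '' W) := by
  rw [Set.image_image]
  refine Set.image_congr fun t _ => ?_
  ext p
  simp only [orderOn, Set.mem_ofPred_eq]
  grind

lemma orderCount_mono {L L' : Finset (Fin n)} (h : L' ⊆ L) {W W' : Set ℕ} (hW : W' ⊆ W) :
    orderCount α L' W' ≤ orderCount α L W := by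
  unfold orderCount
  rw [image_orderOn h]
  exact (Set.ncard_image_le (Set.toFinite _)).trans
    (Set.ncard_le_ncard (Set.image_mono hW) (Set.toFinite _))

lemma orderCount_lt {L L' : Finset (Fin n)} (h : L' ⊆ L) {W : Set ℕ} {s t : ℕ} (hs : s ∈ W)
    (ht : t ∈ W) (hne : orderOn α L s ≠ orderOn α L t) (heq : orderOn α L' s = orderOn α L' t) :
    orderCount α L' W < orderCount α L W := by
  refine lt_of_le_of_ne (orderCount_mono h subset_rfl) fun hcard => hne ?_
  unfold orderCount at hcard
  rw [image_orderOn h] at hcard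
  refine Set.injOn_of_ncard_image_eq hcard (Set.toFinite _) (Set.mem_image_of_mem _ hs)
    (Set.mem_image_of_mem _ ht) ?_
  have hi (u : ℕ) : {p ∈ orderOn α L u | p.1 ∈ L' ∧ p.2 ∈ L'} = orderOn α L' u := by
    ext p
    simp only [orderOn, Set.mem_ofPred_eq]
    grind
  simp only [hi, heq]

lemma orderCount_pos (L : Finset (Fin n)) {W : Set ℕ} (hW : W.Nonempty) :
    0 < orderCount α L W :=
  (Set.ncard_pos (Set.toFinite _)).2 (hW.image _)

/-- From time `T` on, the functions `ψ_{α_i}` take distinct values and no two of them share a pair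
of consecutive jumps. -/
structure SeparatedFrom (α : Fin n → ℝ) (T : ℕ) : Prop where
  irrational : ∀ i, Irrational (α i)
  two_le : 2 ≤ T
  psi_ne : ∀ i j, i ≠ j → ∀ t : ℕ, T ≤ t → psi (α i) t ≠ psi (α j) t
  not_isConsecutive : ∀ i j, i ≠ j → ∀ a b, T ≤ b → IsConsecutive (α i) a b →
    ¬ IsConsecutive (α j) a b

variable {T₀ : ℕ}

lemma SeparatedFrom.orderOn_pred_eq (h : SeparatedFrom α T₀) {L : Finset (Fin n)} {T : ℕ}
    (hT : T₀ ≤ T)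
    (htop : ∀ i ∈ L, IsJump (α i) T → ∀ j ∈ L, j ≠ i → psi (α j) T < psi (α i) T) :
    orderOn α L (T - 1) = orderOn α L T := by
  have h2 := h.two_le
  have hstay (i : Fin n) (hi : ¬ IsJump (α i) T) : psi (α i) (T - 1 : ℕ) = psi (α i) T :=
    psi_eq_pred_of_not_isJump (h.irrational i) (by omega) hi
  have hanti (i : Fin n) : psi (α i) T ≤ psi (α i) (T - 1 : ℕ) :=
    psi_antitone (by omega) (by omega)
  have htop' : ∀ i ∈ L, IsJump (α i) T → ∀ j ∈ L, j ≠ i →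
      psi (α j) T < psi (α i) T ∧ psi (α j) (T - 1 : ℕ) < psi (α i) (T - 1 : ℕ) := by
    intro i hi hji j hj hne
    have hlt := htop i hi hji j hj hne
    have hjj : ¬ IsJump (α j) T := fun hjj => (htop j hj hjj i hi hne.symm).not_gt hlt
    exact ⟨hlt, by rw [hstay j hjj]; exact hlt.trans_le (hanti i)⟩
  rw [orderOn_eq_iff]
  intro i hi j hj
  rcases eq_or_ne i j with rfl | hij
  · simp
  by_cases hji : IsJump (α i) T
  · obtain ⟨h1, h1'⟩ := htop' i hi hji j hj hij.symm
    exact iff_of_false h1'.not_gt h1.not_gt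
  by_cases hjj : IsJump (α j) T
  · obtain ⟨h1, h1'⟩ := htop' j hj hjj i hi hij
    exact iff_of_true h1' h1
  rw [hstay i hji, hstay j hjj]

lemma SeparatedFrom.exists_orderOn_erase_eq (h : SeparatedFrom α T₀) {L : Finset (Fin n)}
    (hL : L.Nonempty) {T b : ℕ} (hT : T₀ < T) (hTb : T < b) (hb : ∀ i ∈ L, IsJump (α i) b)
    (hconst : ∀ t, T ≤ t → t < b → orderOn α L t = orderOn α L T) :
    ∃ x ∈ L, orderOn α (L.erase x) (T - 1) = orderOn α (L.erase x) T := by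
  have h2 := h.two_le
  have htop : ∀ i ∈ L, IsJump (α i) T → ¬ IsConsecutive (α i) T b →
      ∀ j ∈ L, j ≠ i → psi (α j) T < psi (α i) T := by
    intro i hi hjT hnc j hj hne
    obtain ⟨a, ha⟩ := (hb i hi).exists_prev (h.irrational i) (by omega)
    have hTa : T < a := by
      refine lt_of_le_of_ne (ha.ge_of_isJump hjT hTb) ?_
      rintro rfl
      exact hnc ha
    exact psi_lt_of_isJump (h.irrational i) (h.irrational j) (hb j hj) hjT ha hTa
      (fun t ht => h.psi_ne i j hne.symm t (by omega))
      (fun t h1 h2 => orderOn_eq_iff.1 (hconst t h1 h2) i hi j hj)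
  obtain ⟨x, hx, hx'⟩ : ∃ x ∈ L, ∀ i ∈ L, i ≠ x → ¬ IsConsecutive (α i) T b := by
    by_cases hex : ∃ x ∈ L, IsConsecutive (α x) T b
    · obtain ⟨x, hx, hxc⟩ := hex
      exact ⟨x, hx, fun i _ hix => h.not_isConsecutive x i hix.symm T b (by omega) hxc⟩
    · push Not at hex
      obtain ⟨x, hx⟩ := hL
      exact ⟨x, hx, fun i hi _ => hex i hi⟩
  refine ⟨x, hx, h.orderOn_pred_eq hT.le fun i hi hji j hj hne => ?_⟩
  exact htop i (Finset.mem_of_mem_erase hi) hji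
    (hx' i (Finset.mem_of_mem_erase hi) (Finset.ne_of_mem_erase hi)) j
    (Finset.mem_of_mem_erase hj) hne

lemma SeparatedFrom.card_le_orderCount (h : SeparatedFrom α T₀) {b : ℕ} (hTb : T₀ < b)
    (hrev : ∀ i j, i ≠ j → ∃ t : ℕ, T₀ ≤ t ∧ t < b ∧ psi (α i) t < psi (α j) t)
    (L : Finset (Fin n)) (hb : ∀ i ∈ L, IsJump (α i) b) :
    L.card ≤ orderCount α L (Set.Ico T₀ b) := by
  classical
  induction hm : L.card generalizing L with
  | zero => exact Nat.zero_le _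
  | succ m ih =>
    rcases m.eq_zero_or_pos with rfl | hmpos
    · exact orderCount_pos L ⟨T₀, le_rfl, hTb⟩
    obtain ⟨i, hi, j, hj, hij⟩ := Finset.one_lt_card.1 (show 1 < L.card by omega)
    let P : ℕ → Prop := fun T => T₀ < T ∧ T < b ∧ orderOn α L (T - 1) ≠ orderOn α L T
    obtain ⟨u, hu⟩ : ∃ u, P u := by
      by_contra! hP
      have hc (t : ℕ) (h1 : T₀ ≤ t) (h2 : t < b) : orderOn α L t = orderOn α L T₀ :=
        eq_of_forall_pred_eq h1 fun u h3 h4 => by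
          by_contra hne
          exact hP u ⟨h3, by omega, hne⟩
      obtain ⟨t, ht, ht', hlt⟩ := hrev i j hij
      obtain ⟨s, hs, hs', hls⟩ := hrev j i hij.symm
      have := (orderOn_eq_iff.1 ((hc s hs hs').trans (hc t ht ht').symm) i hi j hj).2 hlt
      exact this.not_gt hls
    obtain ⟨hT, hTb', hne⟩ : P (Nat.findGreatest P b) :=
      Nat.findGreatest_spec (m := u) hu.2.1.le hu
    obtain ⟨x, hx, hx'⟩ := h.exists_orderOn_erase_eq (L := L) ⟨i, hi⟩ hT hTb' hb
      fun t h1 h2 => eq_of_forall_pred_eq h1 fun u h3 h4 => by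
        by_contra hne'
        exact Nat.findGreatest_is_greatest h3 (by omega) ⟨by omega, by omega, hne'⟩
    have hle := ih (L.erase x) (fun y hy => hb y (Finset.mem_of_mem_erase hy))
      (by rw [Finset.card_erase_of_mem hx]; omega)
    have hlt := orderCount_lt (Finset.erase_subset x L) (W := Set.Ico T₀ b)
      ⟨by omega, by omega⟩ ⟨hT.le, hTb'⟩ hne hx'
    omega

lemma SeparatedFrom.exists_psi_lt (h : SeparatedFrom α T₀) {i j : Fin n} (hij : i ≠ j) (N : ℕ) :
    ∃ t : ℕ, N ≤ t ∧ psi (α i) t < psi (α j) t :=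
  _root_.exists_psi_lt (h.irrational i) (h.irrational j) ⟨T₀, h.psi_ne i j hij⟩ N

lemma SeparatedFrom.exists_forall_exists_psi_lt (h : SeparatedFrom α T₀) :
    ∃ T₁, T₀ ≤ T₁ ∧ ∀ i j, i ≠ j → ∃ t : ℕ, T₀ ≤ t ∧ t < T₁ ∧ psi (α i) t < psi (α j) t := by
  have key : ∀ᶠ T₁ in Filter.atTop, ∀ i j, i ≠ j →
      ∃ t : ℕ, T₀ ≤ t ∧ t < T₁ ∧ psi (α i) t < psi (α j) t := by
    simp only [Filter.eventually_all]
    intro i j hij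
    obtain ⟨t, ht, hlt⟩ := h.exists_psi_lt hij T₀
    filter_upwards [Filter.eventually_gt_atTop t] with T₁ hT₁
    exact ⟨t, ht, hT₁, hlt⟩
  exact ((Filter.eventually_ge_atTop T₀).and key).exists

lemma SeparatedFrom.card_le (h : SeparatedFrom α T₀) (I : Finset (Fin n)) :
    2 * I.card ≤ orderCount α I (Set.Ici T₀) * (orderCount α I (Set.Ici T₀) + 1) := by
  classical
  induction I using Finset.strongInduction with
  | H I ih =>
    have hpos := orderCount_pos (α := α) I (W := Set.Ici T₀) Set.nonempty_Ici
    rcases le_or_gt I.card 1 with hI | hI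
    · nlinarith
    obtain ⟨i, hi, j, hj, hij⟩ := Finset.one_lt_card.1 hI
    obtain ⟨T₁, hT₁, hrev⟩ := h.exists_forall_exists_psi_lt
    obtain ⟨b, hb, hne⟩ : ∃ b, T₁ < b ∧ orderOn α I (b - 1) ≠ orderOn α I b := by
      by_contra! hc
      obtain ⟨t, ht, hlt⟩ := h.exists_psi_lt hij T₁
      obtain ⟨s, hs, hls⟩ := h.exists_psi_lt hij.symm T₁
      have h1 := eq_of_forall_pred_eq ht fun u h3 _ => hc u h3
      have h2 := eq_of_forall_pred_eq hs fun u h3 _ => hc u h3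
      exact ((orderOn_eq_iff.1 (h2.trans h1.symm) i hi j hj).2 hlt).not_gt hls
    set J := I.filter fun i => IsJump (α i) b with hJ
    have hJI : J ⊆ I := Finset.filter_subset _ _
    have heq : orderOn α (I \ J) (b - 1) = orderOn α (I \ J) b := by
      refine h.orderOn_pred_eq (by omega) fun i hi hji => ?_
      simp [hJ, hji] at hi
    have hcJ : J.card ≤ orderCount α J (Set.Ico T₀ b) :=
      h.card_le_orderCount (by omega)
        (fun i j hij => by
          obtain ⟨t, h1, h2, h3⟩ := hrev i j hij
          exact ⟨t, h1, by omega, h3⟩)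
        J fun i hi => (Finset.mem_filter.1 hi).2
    have hJk : J.card ≤ orderCount α I (Set.Ici T₀) :=
      hcJ.trans (orderCount_mono hJI fun _ ht => ht.1)
    have hlt : orderCount α (I \ J) (Set.Ici T₀) < orderCount α I (Set.Ici T₀) :=
      orderCount_lt Finset.sdiff_subset (Set.mem_Ici.2 (by omega)) (Set.mem_Ici.2 (by omega))
        hne heq
    have hss : I \ J ⊂ I := by
      refine Finset.sdiff_subset.ssubset_of_ne fun hIJ => hne ?_
      rwa [hIJ] at heq
    have hcard : (I \ J).card + J.card = I.card := Finset.card_sdiff_add_card_eq_card hJI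
    have := ih _ hss
    nlinarith

lemma exists_isOrderVec {t : ℝ} (h : ∀ i j, i ≠ j → psi (α i) t ≠ psi (α j) t) :
    ∃ v, IsOrderVec α t v := by
  set f : Fin n → ℝ := fun i => -psi (α i) t with hf
  have hmono : StrictMono (f ∘ Tuple.sort f) := by
    refine (Tuple.monotone_sort f).strictMono_of_injective
      (Function.Injective.comp (fun i j hij => ?_) (Tuple.sort f).injective)
    by_contra hne
    exact h i j hne (neg_injective hij)
  exact ⟨Tuple.sort f, (Tuple.sort f).bijective, fun p q hpq => neg_lt_neg_iff.1 (hmono hpq)⟩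

lemma IsOrderVec.orderOn_univ {t : ℕ} {v : Fin n → Fin n} (h : IsOrderVec α t v) :
    orderOn α Finset.univ t = {p | ∃ a b, a < b ∧ p = (v b, v a)} := by
  ext ⟨i, j⟩
  obtain ⟨b, rfl⟩ := h.1.2 i
  obtain ⟨a, rfl⟩ := h.1.2 j
  simp only [orderOn, Finset.mem_univ, true_and, Set.mem_ofPred_eq, Prod.mk.injEq]
  constructor
  · intro hlt
    refine ⟨a, b, ?_, rfl, rfl⟩
    rcases lt_trichotomy a b with hab | rfl | hab
    · exact hab
    · exact absurd hlt (lt_irrefl _)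
    · exact absurd hlt (h.2 b a hab).not_gt
  · rintro ⟨a', b', hab, hb, ha⟩
    rw [hb, ha]
    exact h.2 a' b' hab

lemma orderCount_univ_le_kAlpha (h : SeparatedFrom α T₀)
    (hocc : ∀ t : ℕ, T₀ ≤ t → ∀ v, IsOrderVec α t v → OccursInfinitely α v) :
    orderCount α Finset.univ (Set.Ici T₀) ≤ kAlpha α := by
  have hsub : orderOn α Finset.univ '' Set.Ici T₀ ⊆
      (fun v : Fin n → Fin n => {p : Fin n × Fin n | ∃ a b, a < b ∧ p = (v b, v a)}) ''
        {v | OccursInfinitely α v} := by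
    rintro _ ⟨t, ht, rfl⟩
    obtain ⟨v, hv⟩ := exists_isOrderVec (α := α) (t := t) fun i j hij => h.psi_ne i j hij t ht
    exact ⟨v, hocc t ht v hv, hv.orderOn_univ.symm⟩
  exact (Set.ncard_le_ncard hsub (Set.toFinite _)).trans (Set.ncard_image_le (Set.toFinite _))

lemma exists_separatedFrom (hirr : ∀ i, Irrational (α i)) (hind : PairwiseIndependent α) :
    ∃ T₀, SeparatedFrom α T₀ ∧
      ∀ t : ℕ, T₀ ≤ t → ∀ v, IsOrderVec α t v → OccursInfinitely α v := by
  obtain ⟨T, -, hT⟩ := hind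
  have hcons : ∀ᶠ N : ℕ in Filter.atTop, ∀ i j, i ≠ j → ∀ a b, N ≤ b →
      IsConsecutive (α i) a b → ¬ IsConsecutive (α j) a b := by
    rw [Filter.eventually_all]
    intro i
    rw [Filter.eventually_all]
    intro j
    by_cases hij : i = j
    · simp [hij]
    obtain ⟨N, hN⟩ := exists_forall_not_isConsecutive (hirr i) (hirr j) ⟨T, hT T le_rfl i j hij⟩
    filter_upwards [Filter.eventually_ge_atTop N] with M hM _ a b hb
    exact hN a b (hM.trans hb)
  have hocc : ∀ᶠ N : ℕ in Filter.atTop, ∀ v, ∀ t : ℕ, N ≤ t → IsOrderVec α t v →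
      OccursInfinitely α v := by
    rw [Filter.eventually_all]
    intro v
    by_cases hv : OccursInfinitely α v
    · simp [hv]
    · have hv' := hv
      unfold OccursInfinitely at hv'
      push Not at hv'
      obtain ⟨S, hS⟩ := hv'
      obtain ⟨N, hN⟩ := exists_nat_gt S
      filter_upwards [Filter.eventually_ge_atTop N] with M hM t ht hvt
      exact absurd hvt (hS t (hN.trans_le (by exact_mod_cast hM.trans ht)))
  obtain ⟨N, hN2, hNT, hNc, hNo⟩ := ((Filter.eventually_ge_atTop 2).and
    ((Filter.eventually_ge_atTop ⌈T⌉₊).and (hcons.and hocc))).exists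
  exact ⟨N, ⟨hirr, hN2, fun i j hij t ht => hT t (Nat.ceil_le.1 (hNT.trans ht)) i j hij, hNc⟩,
    fun t ht v => hNo v t ht⟩

end Order

/-- If `α` is an `n`-tuple of pairwise independent irrational numbers with `k(α) = k`,
then `n ≤ k(k+1)/2`. -/
theorem stmt2 (n k : ℕ) (α : Fin n → ℝ) (hirr : ∀ i, Irrational (α i))
    (hind : PairwiseIndependent α) (hka : kAlpha α = k) :
    n ≤ k * (k + 1) / 2 := by
  obtain ⟨T₀, hsep, hocc⟩ := exists_separatedFrom hirr hind
  have hcard := hsep.card_le Finset.univ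
  have hle := orderCount_univ_le_kAlpha hsep hocc
  rw [hka] at hle
  rw [Finset.card_univ, Fintype.card_fin] at hcard
  rw [Nat.le_div_iff_mul_le two_pos, mul_comm]
  exact hcard.trans (Nat.mul_le_mul hle (Nat.succ_le_succ hle))
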